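/- Let α, β > -1 be real numbers with (α, β) ∉ S, i.e. either β > α or α < -1/2. Then there exists a function f ∈ L_{(α,β)} such that the sequence of Fourier–Jacobi coefficients f̂_{(α,β)}(k) does not converge to 0 as k → ∞. -/

import Mathlib

open MeasureTheory Filter Set

noncomputable section

/-- Generalized binomial coefficient `C(a, m) = Γ(a+1)/(Γ(m+1)Γ(a-m+1))`. -/
def genBinom (a : ℝ) (m : ℕ) : ℝ :=
  Real.Gamma (a + 1) / (Real.Gamma ((m : ℝ) + 1) * Real.Gamma (a - (m : ℝ) + 1))

/-- The Jacobi polynomial `P_k^{(α,β)}(x)`. -/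
def jacobiP (α β : ℝ) (k : ℕ) (x : ℝ) : ℝ :=
  ∑ s ∈ Finset.range (k + 1),
    genBinom ((k : ℝ) + α) (k - s) * genBinom ((k : ℝ) + β) s *
      ((x - 1) / 2) ^ s * ((x + 1) / 2) ^ (k - s)

/-- The normalized Jacobi polynomial `R_k^{(α,β)}(x) = P_k^{(α,β)}(x)/P_k^{(α,β)}(1)`. -/
def jacobiR (α β : ℝ) (k : ℕ) (x : ℝ) : ℝ := jacobiP α β k x / jacobiP α β k 1

/-- The Jacobi weight `(sin(θ/2))^{2α+1} (cos(θ/2))^{2β+1}`. -/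
def jacobiWeight (α β : ℝ) (θ : ℝ) : ℝ :=
  Real.sin (θ / 2) ^ (2 * α + 1) * Real.cos (θ / 2) ^ (2 * β + 1)

/-- `f ∈ L_{(α,β)}`: `f` is integrable on `[0,π]` against the Jacobi weight. -/
def MemJacobiL (α β : ℝ) (f : ℝ → ℝ) : Prop :=
  IntegrableOn (fun θ => f θ * jacobiWeight α β θ) (Ioc 0 Real.pi)

/-- The norm `‖f‖_{L_{(α,β)}}`. -/
def jacobiNorm (α β : ℝ) (f : ℝ → ℝ) : ℝ :=
  ∫ θ in Ioc (0 : ℝ) Real.pi, |f θ| * jacobiWeight α β θ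

/-- The `k`-th Fourier–Jacobi coefficient `f̂_{(α,β)}(k)`. -/
def fourierJacobi (α β : ℝ) (f : ℝ → ℝ) (k : ℕ) : ℝ :=
  ∫ θ in Ioc (0 : ℝ) Real.pi, f θ * jacobiR α β k (Real.cos θ) * jacobiWeight α β θ

end

/-- A positive sequence whose consecutive ratios are eventually at least `1 + c / (k + 1)` is
unbounded. -/
lemma exists_lt_of_one_add_div_mul_le {a : ℕ → ℝ} {c : ℝ} (hc : 0 < c) {K : ℕ} (hK : 0 < a K)
    (h : ∀ k ≥ K, (1 + c / (k + 1)) * a k ≤ a (k + 1)) (C : ℝ) : ∃ k ≥ K, C < a k := by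
  have key : ∀ n, K ≤ n → a K * (1 + c * (∑ i ∈ Finset.range n, 1 / ((i : ℝ) + 1) -
      ∑ i ∈ Finset.range K, 1 / ((i : ℝ) + 1))) ≤ a n ∧ a K ≤ a n := by
    intro n hn
    induction n, hn using Nat.le_induction with
    | base => simp
    | succ n hn ih =>
      obtain ⟨ih, ih'⟩ := ih
      have hstep := h n hn
      have hx : 0 < c / ((n : ℝ) + 1) := by positivity
      have hmul : c / ((n : ℝ) + 1) * a K ≤ c / ((n : ℝ) + 1) * a n := by gcongr
      refine ⟨?_, by nlinarith [mul_pos hx hK]⟩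
      rw [Finset.sum_range_succ]
      have : c / ((n : ℝ) + 1) = c * (1 / ((n : ℝ) + 1)) := by ring
      rw [this] at hstep hmul
      nlinarith
  have hdiv := Real.tendsto_sum_range_one_div_nat_succ_atTop
  set S := ∑ i ∈ Finset.range K, 1 / ((i : ℝ) + 1)
  obtain ⟨n, hn, hnK⟩ := ((hdiv.eventually_gt_atTop (S + |C| / (a K * c))).and
    (eventually_ge_atTop K)).exists
  refine ⟨n, hnK, lt_of_lt_of_le ?_ (key n hnK).1⟩
  have h1 : |C| / (a K * c) < ∑ i ∈ Finset.range n, 1 / ((i : ℝ) + 1) - S := by linarith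
  rw [div_lt_iff₀ (by positivity)] at h1
  nlinarith [le_abs_self C]

lemma eventually_quadratic_nonneg {A : ℝ} (hA : 0 < A) (B C : ℝ) :
    ∀ᶠ k : ℕ in atTop, 0 ≤ A * (k : ℝ) ^ 2 + B * k + C := by
  filter_upwards [(tendsto_natCast_atTop_atTop (R := ℝ)).eventually_ge_atTop
    ((|B| + |C|) / A + 1)] with k hk
  have h0 : 0 ≤ (|B| + |C|) / A := by positivity
  have h1 : |B| + |C| ≤ A * k := by
    have : (|B| + |C|) / A ≤ k := by linarith
    rw [div_le_iff₀ hA] at this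
    linarith
  have hk1 : (1 : ℝ) ≤ k := by linarith
  nlinarith [neg_abs_le B, neg_abs_le C, abs_nonneg B, abs_nonneg C,
    mul_le_mul_of_nonneg_right h1 (by linarith : (0 : ℝ) ≤ k),
    mul_nonneg (abs_nonneg C) (by linarith : (0 : ℝ) ≤ (k : ℝ) - 1),
    mul_nonneg (by linarith [neg_abs_le B] : 0 ≤ B + |B|) (by linarith : (0 : ℝ) ≤ (k : ℝ))]

lemma Gamma_add_one_eq_descPochhammer_mul (a : ℝ) (m : ℕ) (h : 0 < a - m + 1) :
    Real.Gamma (a + 1) = (descPochhammer ℤ m).smeval a * Real.Gamma (a - m + 1) := by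
  induction m with
  | zero => simp
  | succ m ih =>
    push_cast at h ⊢
    rw [ih (by linarith), descPochhammer_succ_right, Polynomial.smeval_mul,
      Polynomial.smeval_sub, Polynomial.smeval_X, Polynomial.smeval_natCast,
      Real.Gamma_add_one (by linarith : a - m ≠ 0)]
    simp only [pow_one, pow_zero, nsmul_eq_mul, mul_one]
    rw [show a - (m + 1 : ℝ) + 1 = a - m by ring]
    ring

lemma genBinom_eq_choose (a : ℝ) (m : ℕ) (h : 0 < a - m + 1) :
    genBinom a m = Ring.choose a m := by
  have hG := (Real.Gamma_pos_of_pos h).ne'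
  rw [genBinom, Ring.choose_eq_smul, Gamma_add_one_eq_descPochhammer_mul a m h,
    Real.Gamma_nat_eq_factorial]
  have := Nat.factorial_ne_zero m
  simp only [smul_eq_mul]
  field_simp

lemma genBinom_pos {a : ℝ} {m : ℕ} (h : 0 < a - m + 1) : 0 < genBinom a m := by
  have : (0 : ℝ) ≤ m := by positivity
  exact div_pos (Real.Gamma_pos_of_pos (by linarith))
    (mul_pos (Real.Gamma_pos_of_pos (by positivity)) (Real.Gamma_pos_of_pos h))

lemma sum_genBinom_mul_genBinom {α β : ℝ} (hα : -1 < α) (hβ : -1 < β) {k : ℕ} (hk : 1 ≤ k) :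
    ∑ s ∈ Finset.range (k + 1), genBinom ((k : ℝ) + α) (k - s) * genBinom ((k : ℝ) + β) s =
      genBinom (2 * k + α + β) k := by
  have hk' : (1 : ℝ) ≤ k := by exact_mod_cast hk
  rw [genBinom_eq_choose _ _ (by linarith),
    show (2 * k + α + β : ℝ) = (k + β) + (k + α) by ring,
    Ring.add_choose_eq k (Commute.all _ _), Finset.Nat.sum_antidiagonal_eq_sum_range_succ_mk]
  refine Finset.sum_congr rfl fun s hs => ?_
  have hs' : s ≤ k := Finset.mem_range_succ_iff.mp hs
  have hs'' : (s : ℝ) ≤ k := by exact_mod_cast hs'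
  have hs0 : (0 : ℝ) ≤ s := by positivity
  rw [genBinom_eq_choose _ _ (by push_cast [hs']; linarith),
    genBinom_eq_choose _ _ (by linarith), mul_comm]

lemma genBinom_zero_right {a : ℝ} (h : 0 < a + 1) : genBinom a 0 = 1 := by
  rw [genBinom_eq_choose _ _ (by simpa using h), Ring.choose_zero_right]

lemma jacobiP_one {α β : ℝ} (hβ : -1 < β) (k : ℕ) :
    jacobiP α β k 1 = genBinom (k + α) k := by
  have hk : (0 : ℝ) ≤ k := by positivity
  rw [jacobiP, Finset.sum_eq_single 0]
  · rw [genBinom_zero_right (by linarith)]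
    norm_num
  · intro s _ hs
    simp [hs]
  · simp

lemma jacobiP_one_pos {α β : ℝ} (hα : -1 < α) (hβ : -1 < β) (k : ℕ) :
    0 < jacobiP α β k 1 := by
  rw [jacobiP_one hβ]
  exact genBinom_pos (by linarith)

lemma jacobiP_neg_one {α β : ℝ} (hα : -1 < α) (k : ℕ) :
    jacobiP α β k (-1) = (-1) ^ k * genBinom (k + β) k := by
  have hk : (0 : ℝ) ≤ k := by positivity
  rw [jacobiP, Finset.sum_eq_single k]
  · rw [Nat.sub_self, genBinom_zero_right (by linarith)]
    norm_num
    ring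
  · intro s hs hsk
    have : k - s ≠ 0 := by
      have := Finset.mem_range_succ_iff.mp hs
      omega
    simp [this]
  · simp

lemma genBinom_natCast_add_self_succ {α : ℝ} (hα : -1 < α) (k : ℕ) :
    genBinom ((k + 1 : ℕ) + α) (k + 1) = (k + α + 1) / (k + 1) * genBinom (k + α) k := by
  have hk : (0 : ℝ) ≤ k := by positivity
  have h1 : (k : ℝ) + α + 1 ≠ 0 := by linarith
  have h2 : (k : ℝ) + 1 ≠ 0 := by positivity
  simp only [genBinom]
  push_cast
  rw [show (k : ℝ) + 1 + α + 1 = (k + α + 1) + 1 by ring, Real.Gamma_add_one h1,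
    Real.Gamma_add_one h2,
    show (k : ℝ) + 1 + α - (k + 1) + 1 = α + 1 by ring,
    show (k : ℝ) + α - k + 1 = α + 1 by ring]
  have := (Real.Gamma_pos_of_pos (by linarith : 0 < α + 1)).ne'
  have := (Real.Gamma_pos_of_pos (by positivity : 0 < (k : ℝ) + 1)).ne'
  field_simp

lemma genBinom_two_mul_add_succ {γ : ℝ} {k : ℕ} (hγ : 0 < k + γ + 1) :
    genBinom (2 * (k + 1 : ℕ) + γ) (k + 1) =
      (2 * k + γ + 1) * (2 * k + γ + 2) / ((k + 1) * (k + γ + 1)) * genBinom (2 * k + γ) k := by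
  have hk : (0 : ℝ) ≤ k := by positivity
  have h2 : (k : ℝ) + 1 ≠ 0 := by positivity
  simp only [genBinom]
  push_cast
  rw [show 2 * ((k : ℝ) + 1) + γ + 1 = (2 * k + γ + 1 + 1) + 1 by ring,
    Real.Gamma_add_one (by linarith : 2 * (k : ℝ) + γ + 1 + 1 ≠ 0),
    Real.Gamma_add_one (by linarith : 2 * (k : ℝ) + γ + 1 ≠ 0),
    Real.Gamma_add_one h2,
    show 2 * ((k : ℝ) + 1) + γ - (k + 1) + 1 = (k + γ + 1) + 1 by ring,
    show 2 * (k : ℝ) + γ - k + 1 = k + γ + 1 by ring, Real.Gamma_add_one hγ.ne']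
  have := (Real.Gamma_pos_of_pos hγ).ne'
  have := (Real.Gamma_pos_of_pos (by positivity : 0 < (k : ℝ) + 1)).ne'
  field_simp
  ring

lemma exists_lt_abs_jacobiR_neg_one {α β : ℝ} (hα : -1 < α) (hβ : -1 < β) (h : α < β) (C : ℝ) :
    ∃ k, C < |jacobiR α β k (-1)| := by
  have hpos : ∀ {γ : ℝ}, -1 < γ → ∀ k : ℕ, 0 < genBinom (k + γ) k :=
    fun hγ k => genBinom_pos (by linarith)
  obtain ⟨K, hK⟩ := exists_nat_ge α
  obtain ⟨k, -, hk⟩ := exists_lt_of_one_add_div_mul_le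
    (a := fun k : ℕ => genBinom (k + β) k / genBinom (k + α) k) (c := (β - α) / 2) (K := K)
    (by linarith) (div_pos (hpos hβ K) (hpos hα K)) (fun k hk => by
      have hk' : (K : ℝ) ≤ k := by exact_mod_cast hk
      have hk0 : (0 : ℝ) ≤ k := by positivity
      have hα' : 0 < (k : ℝ) + α + 1 := by linarith
      have h1 := hpos hα k
      have h2 := hpos hβ k
      have h3 : (k + β + 1) / (k + 1) * genBinom (k + β) k /
          ((k + α + 1) / (k + 1) * genBinom (k + α) k) =
          (k + β + 1) / (k + α + 1) * (genBinom (k + β) k / genBinom (k + α) k) := by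
        field_simp
      rw [genBinom_natCast_add_self_succ hα, genBinom_natCast_add_self_succ hβ, h3]
      refine mul_le_mul_of_nonneg_right ?_ (by positivity)
      rw [le_div_iff₀ hα', add_mul, div_mul_eq_mul_div, one_mul, ← le_sub_iff_add_le',
        div_le_iff₀ (by positivity)]
      nlinarith) C
  refine ⟨k, hk.trans_eq ?_⟩
  rw [jacobiR, jacobiP_one hβ, jacobiP_neg_one hα, abs_div, abs_mul, abs_neg_one_pow, one_mul,
    abs_of_pos (hpos hα k), abs_of_pos (hpos hβ k)]

open Polynomial in
lemma exists_polynomial_jacobiP {α β : ℝ} (hα : -1 < α) (hβ : -1 < β) {k : ℕ} (hk : 1 ≤ k) :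
    ∃ P : ℝ[X], P.degree ≤ k ∧ P.coeff k = genBinom (2 * k + α + β) k / 2 ^ k ∧
      ∀ x, P.eval x = jacobiP α β k x := by
  have hdeg : ∀ s ∈ Finset.range (k + 1),
      ((C (1 / 2) * X + C (-(1 / 2)) : ℝ[X]) ^ s *
        (C (1 / 2) * X + C (1 / 2) : ℝ[X]) ^ (k - s)).natDegree ≤ k ∧
      ((C (1 / 2) * X + C (-(1 / 2)) : ℝ[X]) ^ s *
        (C (1 / 2) * X + C (1 / 2) : ℝ[X]) ^ (k - s)).coeff k = 1 / 2 ^ k := by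
    intro s hs
    have hs' := Finset.mem_range_succ_iff.mp hs
    have hlin : ∀ (b : ℝ) (n : ℕ), ((C (1 / 2) * X + C b : ℝ[X]) ^ n).natDegree = n ∧
        ((C (1 / 2) * X + C b : ℝ[X]) ^ n).coeff n = (1 / 2) ^ n := by
      intro b n
      have h1 : (C (1 / 2) * X + C b : ℝ[X]).natDegree = 1 := natDegree_linear (by norm_num)
      refine ⟨by rw [natDegree_pow, h1, mul_one], ?_⟩
      have h2 := coeff_pow_of_natDegree_le (m := n) h1.le
      simpa using h2
    have e : k = s + (k - s) := by omega
    refine ⟨natDegree_mul_le.trans (by rw [(hlin _ _).1, (hlin _ _).1]; omega), ?_⟩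
    conv_lhs => rw [e]
    rw [Nat.add_sub_cancel_left,
      coeff_mul_add_eq_of_natDegree_le (hlin _ _).1.le (hlin _ _).1.le, (hlin _ _).2,
      (hlin _ _).2, ← pow_add, ← e, one_div_pow]
  refine ⟨∑ s ∈ Finset.range (k + 1),
    C (genBinom ((k : ℝ) + α) (k - s) * genBinom ((k : ℝ) + β) s) *
      ((C (1 / 2) * X + C (-(1 / 2))) ^ s * (C (1 / 2) * X + C (1 / 2)) ^ (k - s)), ?_, ?_, ?_⟩
  · refine degree_le_of_natDegree_le (natDegree_sum_le_of_forall_le _ _ fun s hs => ?_)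
    exact (natDegree_C_mul_le _ _).trans (hdeg s hs).1
  · rw [finsetSum_coeff, ← sum_genBinom_mul_genBinom hα hβ hk, Finset.sum_div]
    refine Finset.sum_congr rfl fun s hs => ?_
    rw [coeff_C_mul, (hdeg s hs).2, mul_one_div]
  · intro x
    rw [eval_finsetSum, jacobiP]
    refine Finset.sum_congr rfl fun s _ => ?_
    simp only [eval_mul, eval_C, eval_pow, eval_add, eval_X]
    rw [show (1 / 2 * x + -(1 / 2) : ℝ) = (x - 1) / 2 by ring,
      show (1 / 2 * x + 1 / 2 : ℝ) = (x + 1) / 2 by ring]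
    ring

open Polynomial in
lemma exists_lt_abs_jacobiR_of_lt_neg_half {α β : ℝ} (hα : -1 < α) (hβ : -1 < β)
    (h : α < -(1 / 2)) (C : ℝ) : ∃ k, ∃ x ∈ Icc (-1 : ℝ) 1, C < |jacobiR α β k x| := by
  by_contra! hcon
  have hC : 0 < max C 1 := by positivity
  have hbound : ∀ k : ℕ, 1 ≤ k →
      genBinom (2 * k + (α + β)) k / (4 ^ k * genBinom (k + α) k) ≤ max C 1 := by
    intro k hk
    obtain ⟨P, hdeg, hcoeff, heval⟩ := exists_polynomial_jacobiP hα hβ hk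
    have hp := jacobiP_one_pos (α := α) hα hβ k
    have hQ := Chebyshev.coeff_le_of_forall_abs_le_one (n := k)
      (P := Polynomial.C (1 / (jacobiP α β k 1 * max C 1)) * P)
      (degree_le_of_natDegree_le
        ((natDegree_C_mul_le _ _).trans (natDegree_le_of_degree_le hdeg))) (fun x hx => by
        rw [eval_mul, eval_C, heval, one_div_mul_eq_div, ← div_div, abs_div, abs_of_pos hC,
          div_le_one hC]
        exact (hcon k x hx).trans (le_max_left _ _))
    rw [coeff_C_mul, hcoeff, one_div_mul_eq_div, div_div,
      div_le_iff₀ (by positivity)] at hQ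
    rw [← jacobiP_one hβ, div_le_iff₀ (by positivity), ← add_assoc]
    have h4 : (4 : ℝ) ^ k = 2 * (2 ^ (k - 1) * 2 ^ k) := by
      obtain ⟨m, rfl⟩ : ∃ m, k = m + 1 := ⟨k - 1, by omega⟩
      rw [show (4 : ℝ) = 2 * 2 by norm_num, mul_pow, Nat.add_sub_cancel]
      ring
    have : 0 ≤ 2 ^ (k - 1) * (2 ^ k * (jacobiP α β k 1 * max C 1)) := by positivity
    rw [h4]
    nlinarith
  set γ := α + β with hγ
  set δ := -(1 / 2) - α with hδ
  have hδ0 : 0 < δ := by linarith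
  obtain ⟨K, hK⟩ := eventually_atTop.mp (eventually_quadratic_nonneg
    (A := δ / 2) (by linarith)
    (δ + ((γ + 1) * (γ + 2) / 4 - (γ + 1) * (α + 1)) - δ / 2 * (γ + α + 2))
    ((γ + 1) * (γ + 2) / 4 - (γ + 1) * (α + 1) - δ / 2 * ((γ + 1) * (α + 1))))
  have hα' : ∀ k : ℕ, 0 < genBinom (k + α) k := fun k => genBinom_pos (by linarith)
  have hγ' : ∀ k : ℕ, 1 ≤ k → 0 < (k : ℝ) + γ + 1 := fun k hk => by
    have : (1 : ℝ) ≤ k := by exact_mod_cast hk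
    linarith
  have hγ'' : ∀ k : ℕ, 1 ≤ k → 0 < genBinom (2 * k + γ) k := fun k hk =>
    genBinom_pos (by linarith [hγ' k hk])
  have h1K : 1 ≤ max K 1 := le_max_right _ _
  obtain ⟨k, hk, hlt⟩ := exists_lt_of_one_add_div_mul_le
    (a := fun k : ℕ => genBinom (2 * k + γ) k / (4 ^ k * genBinom (k + α) k))
    (c := δ / 2) (K := max K 1) (by linarith)
    (div_pos (hγ'' _ h1K) (mul_pos (by positivity) (hα' _))) (fun k hk => by
      have hk1 : 1 ≤ k := h1K.trans hk
      have hkK := hK k ((le_max_left _ _).trans hk)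
      have hk0 : (1 : ℝ) ≤ k := by exact_mod_cast hk1
      have ha : 0 < (k : ℝ) + α + 1 := by linarith
      have hg := hγ' k hk1
      have h1 := hα' k
      have h2 := hγ'' k hk1
      have h3 : (2 * k + γ + 1) * (2 * k + γ + 2) / ((k + 1) * (k + γ + 1)) *
            genBinom (2 * k + γ) k /
          (4 ^ (k + 1) * ((k + α + 1) / (k + 1) * genBinom (k + α) k)) =
          (2 * k + γ + 1) * (2 * k + γ + 2) / (4 * ((k + γ + 1) * (k + α + 1))) *
            (genBinom (2 * k + γ) k / (4 ^ k * genBinom (k + α) k)) := by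
        field_simp
        ring
      rw [genBinom_natCast_add_self_succ hα, genBinom_two_mul_add_succ hg, h3]
      refine mul_le_mul_of_nonneg_right ?_ (by positivity)
      rw [le_div_iff₀ (by positivity), add_mul, div_mul_eq_mul_div, one_mul,
        ← le_sub_iff_add_le', div_le_iff₀ (by positivity)]
      have hα2 : α = -(1 / 2) - δ := by linarith
      nlinarith) (max C 1)
  exact absurd (hbound k (h1K.trans hk)) (not_le.mpr hlt)

lemma continuous_jacobiR (α β : ℝ) (k : ℕ) : Continuous (jacobiR α β k) := by
  unfold jacobiR jacobiP
  fun_prop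

/-- Uniform boundedness principle for integration against a sequence of continuous functions. -/
lemma exists_forall_abs_le_of_bounded_integrals {a b : ℝ} {φ : ℕ → ℝ → ℝ}
    (hφ : ∀ k, Continuous (φ k))
    (hbdd : ∀ g : ℝ → ℝ, IntegrableOn g (Ioc a b) →
      ∃ C, ∀ k, |∫ x in Ioc a b, g x * φ k x| ≤ C) :
    ∃ C, ∀ k, ∀ x ∈ Ioo a b, |φ k x| ≤ C := by
  set μ : Measure ℝ := volume.restrict (Ioc a b)
  have hmem : ∀ k, MemLp (φ k) ⊤ μ := by
    intro k
    obtain ⟨M, hM⟩ := (isCompact_Icc (a := a) (b := b)).exists_bound_of_continuousOn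
      (hφ k).continuousOn
    refine memLp_top_of_bound (hφ k).aestronglyMeasurable M ?_
    filter_upwards [ae_restrict_mem measurableSet_Ioc] with x hx
    exact hM x (Ioc_subset_Icc_self hx)
  let T : ℕ → Lp ℝ 1 μ →L[ℝ] ℝ := fun k =>
    ((ContinuousLinearMap.mul ℝ ℝ).lpPairing μ 1 ⊤).flip (hmem k).toLp
  have hT : ∀ k (g : Lp ℝ 1 μ), T k g = ∫ x in Ioc a b, g x * φ k x := by
    intro k g
    simp only [T, ContinuousLinearMap.flip_apply, ContinuousLinearMap.lpPairing_eq_integral,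
      ContinuousLinearMap.mul_apply']
    refine integral_congr_ae ?_
    filter_upwards [(hmem k).coeFn_toLp] with x hx
    rw [hx]
  obtain ⟨C, hC⟩ := banach_steinhaus (g := T) (fun g => by
    obtain ⟨C, hC⟩ := hbdd g (L1.integrable_coeFn g)
    exact ⟨C, fun k => by rw [hT]; exact hC k⟩)
  have hset : ∀ k (s : Set ℝ), MeasurableSet s → |∫ x in s, φ k x ∂μ| ≤ ∫ _ in s, C ∂μ := by
    intro k s hs
    have h1 := (T k).le_of_opNorm_le (hC k)
      (indicatorConstLp 1 hs (measure_ne_top μ s) (1 : ℝ))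
    rw [hT, norm_indicatorConstLp one_ne_zero ENNReal.one_ne_top] at h1
    have h2 : ∫ x in Ioc a b, indicatorConstLp 1 hs (measure_ne_top μ s) (1 : ℝ) x * φ k x =
        ∫ x in s, φ k x ∂μ := by
      rw [← integral_indicator hs]
      refine integral_congr_ae ?_
      filter_upwards [indicatorConstLp_coeFn (p := 1) (hs := hs) (hμs := measure_ne_top μ s)
        (c := (1 : ℝ))] with x hx
      rw [hx]
      by_cases hxs : x ∈ s <;> simp [hxs]
    rw [h2] at h1
    rw [setIntegral_const, smul_eq_mul, mul_comm]
    simpa using h1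
  have hint : ∀ k, Integrable (φ k) μ := fun k => (hmem k).integrable le_top
  refine ⟨C, fun k x hx => ?_⟩
  have hae : ∀ᵐ x ∂μ, |φ k x| ≤ C := by
    have h1 : φ k ≤ᵐ[μ] fun _ => C := ae_le_of_forall_setIntegral_le (hint k)
      (integrable_const C) fun s hs _ => (le_abs_self _).trans (hset k s hs)
    have h2 : (fun x => -φ k x) ≤ᵐ[μ] fun _ => C := ae_le_of_forall_setIntegral_le (hint k).neg
      (integrable_const C) fun s hs _ => by
        rw [integral_neg]
        exact (neg_le_abs _).trans (hset k s hs)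
    filter_upwards [h1, h2] with x hx1 hx2
    exact abs_le'.mpr ⟨hx1, hx2⟩
  have hopen : IsOpen ({x | C < |φ k x|} ∩ Ioo a b) :=
    (isOpen_lt continuous_const (hφ k).abs).inter isOpen_Ioo
  have hzero : volume ({x | C < |φ k x|} ∩ Ioo a b) = 0 := by
    refine measure_mono_null (t := {x | C < |φ k x|} ∩ Ioc a b)
      (inter_subset_inter_right _ Ioo_subset_Ioc_self) ?_
    rw [← Measure.restrict_apply (isOpen_lt continuous_const (hφ k).abs).measurableSet]
    simpa only [ae_iff, not_le] using hae
  by_contra! hlt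
  exact (hopen.measure_eq_zero_iff volume).mp hzero |>.subset ⟨hlt, hx⟩

lemma jacobiWeight_pos {α β θ : ℝ} (hθ : θ ∈ Ioo 0 Real.pi) : 0 < jacobiWeight α β θ :=
  mul_pos
    (Real.rpow_pos_of_pos (Real.sin_pos_of_pos_of_lt_pi (by linarith [hθ.1])
      (by linarith [hθ.1, hθ.2])) _)
    (Real.rpow_pos_of_pos (Real.cos_pos_of_mem_Ioo ⟨by linarith [hθ.1, hθ.2],
      by linarith [hθ.2]⟩) _)

/-- If all Fourier–Jacobi coefficient sequences tend to zero, then the normalized Jacobi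
polynomials are uniformly bounded on `[-1, 1]`. -/
lemma exists_forall_abs_jacobiR_le {α β : ℝ}
    (h : ∀ f, MemJacobiL α β f → Tendsto (fourierJacobi α β f) atTop (nhds 0)) :
    ∃ C, ∀ k, ∀ x ∈ Icc (-1 : ℝ) 1, |jacobiR α β k x| ≤ C := by
  have hcont : ∀ k, Continuous fun θ => jacobiR α β k (Real.cos θ) := fun k =>
    (continuous_jacobiR α β k).comp Real.continuous_cos
  obtain ⟨C, hC⟩ := exists_forall_abs_le_of_bounded_integrals (a := 0) (b := Real.pi) hcont
    (fun g hg => by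
      have hae : ∀ᵐ θ ∂volume.restrict (Ioc 0 Real.pi), 0 < jacobiWeight α β θ := by
        rw [← restrict_Ioo_eq_restrict_Ioc]
        filter_upwards [ae_restrict_mem measurableSet_Ioo] with θ hθ
        exact jacobiWeight_pos hθ
      have hmem : MemJacobiL α β fun θ => g θ / jacobiWeight α β θ := by
        refine Integrable.congr hg ?_
        filter_upwards [hae] with θ hθ
        rw [div_mul_cancel₀ _ hθ.ne']
      obtain ⟨C, hC⟩ := (h _ hmem).abs.bddAbove_range
      refine ⟨C, fun k => le_trans (le_of_eq ?_) (hC ⟨k, rfl⟩)⟩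
      refine congrArg abs (integral_congr_ae ?_)
      filter_upwards [hae] with θ hθ
      field_simp)
  refine ⟨C, fun k x hx => ?_⟩
  have hclosed : IsClosed {θ | |jacobiR α β k (Real.cos θ)| ≤ C} :=
    isClosed_le (hcont k).abs continuous_const
  have hsub := hclosed.closure_subset_iff.mpr (hC k)
  rw [closure_Ioo Real.pi_pos.ne] at hsub
  simpa [Real.cos_arccos hx.1 hx.2] using
    hsub ⟨Real.arccos_nonneg x, Real.arccos_le_pi x⟩

/-- If `α, β > -1` and `(α, β) ∉ S` (i.e. `β > α` or `α < -1/2`), then there is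
`f ∈ L_{(α,β)}` whose Fourier–Jacobi coefficients do not tend to `0`. -/
theorem exists_jacobi_coeff_not_tendsto_zero (α β : ℝ) (hα : -1 < α) (hβ : -1 < β)
    (h : α < β ∨ α < -(1/2)) :
    ∃ f : ℝ → ℝ, MemJacobiL α β f ∧
      ¬ Tendsto (fun k : ℕ => fourierJacobi α β f k) atTop (nhds 0) := by
  by_contra! hcon
  obtain ⟨C, hC⟩ := exists_forall_abs_jacobiR_le hcon
  rcases h with h | h
  · obtain ⟨k, hk⟩ := exists_lt_abs_jacobiR_neg_one hα hβ h C
    exact absurd (hC k (-1) (by simp)) (not_le.mpr hk)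
  · obtain ⟨k, x, hx, hk⟩ := exists_lt_abs_jacobiR_of_lt_neg_half hα hβ h C
    exact absurd (hC k x hx) (not_le.mpr hk)
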